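/- Suppose 0 < k ≤ q and β = kn/q. Then S_Ω(β,k) does not depend on the domain: for any two smooth bounded open sets Ω, Ω̃ ⊂ ℝⁿ both containing the origin, S_Ω(β,k) = S_{Ω̃}(β,k). -/

import Mathlib

open MeasureTheory Filter Topology Set

noncomputable section

def smoothCpt (n : ℕ) (Ω : Set (EuclideanSpace ℝ (Fin n)))
    (u : EuclideanSpace ℝ (Fin n) → ℝ) : Prop :=
  ContDiff ℝ (⊤ : ℕ∞) u ∧ HasCompactSupport u ∧ tsupport u ⊆ Ω

/-- The weighted energy `I_{Ω;β,k}(u) = ∫_Ω (1+|x|^β |u|^k) |∇u|²`. -/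
def energy (n : ℕ) (Ω : Set (EuclideanSpace ℝ (Fin n))) (β k : ℝ)
    (u : EuclideanSpace ℝ (Fin n) → ℝ) : ℝ :=
  ∫ x in Ω, (1 + ‖x‖ ^ β * |u x| ^ k) * ‖gradient u x‖ ^ 2

/-- `S_Ω(β,k)`: infimum of the weighted energy over `C_c^∞(Ω)` functions normalized in `L^q`. -/
def Sw (n : ℕ) (Ω : Set (EuclideanSpace ℝ (Fin n))) (β k q : ℝ) : ℝ :=
  sInf {c | ∃ u, smoothCpt n Ω u ∧ (∫ x in Ω, |u x| ^ q) = 1 ∧ c = energy n Ω β k u}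

/-- The best Sobolev constant `S`. -/
def Sbest (n : ℕ) (Ω : Set (EuclideanSpace ℝ (Fin n))) (q : ℝ) : ℝ :=
  sInf {c | ∃ u, smoothCpt n Ω u ∧ (∫ x in Ω, |u x| ^ q) = 1 ∧
    c = ∫ x in Ω, ‖gradient u x‖ ^ 2}

lemma norm_gradient_eq_norm_fderiv {n : ℕ} (u : EuclideanSpace ℝ (Fin n) → ℝ)
    (x : EuclideanSpace ℝ (Fin n)) : ‖gradient u x‖ = ‖fderiv ℝ u x‖ :=
  LinearIsometryEquiv.norm_map _ _

lemma setIntegral_rpow_eq_integral {n : ℕ} {Ω : Set (EuclideanSpace ℝ (Fin n))}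
    {u : EuclideanSpace ℝ (Fin n) → ℝ} (hu : tsupport u ⊆ Ω) {q : ℝ} (hq : q ≠ 0) :
    ∫ x in Ω, |u x| ^ q = ∫ x, |u x| ^ q := by
  refine setIntegral_eq_integral_of_forall_compl_eq_zero fun x hx => ?_
  rw [image_eq_zero_of_notMem_tsupport fun h => hx (hu h), abs_zero, Real.zero_rpow hq]

lemma energy_eq_integral {n : ℕ} {Ω : Set (EuclideanSpace ℝ (Fin n))}
    {u : EuclideanSpace ℝ (Fin n) → ℝ} (hu : tsupport u ⊆ Ω) (β k : ℝ) :
    energy n Ω β k u = ∫ x, (1 + ‖x‖ ^ β * |u x| ^ k) * ‖fderiv ℝ u x‖ ^ 2 := by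
  simp only [energy, norm_gradient_eq_norm_fderiv]
  refine setIntegral_eq_integral_of_forall_compl_eq_zero fun x hx => ?_
  rw [image_eq_zero_of_notMem_tsupport fun h => hx (hu (tsupport_fderiv_subset ℝ h))]
  simp

/-- The dilation `x ↦ l ^ (n / q) * u (l • x)`, which preserves the `L^q` norm. -/
def dilate {n : ℕ} (q l : ℝ) (u : EuclideanSpace ℝ (Fin n) → ℝ)
    (x : EuclideanSpace ℝ (Fin n)) : ℝ :=
  l ^ (n / q) * u (l • x)

lemma smoothCpt_dilate {n : ℕ} {Ω Ω' : Set (EuclideanSpace ℝ (Fin n))} {q l : ℝ} (hl : 0 < l)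
    (hsub : ∀ x, l • x ∈ Ω → x ∈ Ω') {u : EuclideanSpace ℝ (Fin n) → ℝ}
    (hu : smoothCpt n Ω u) : smoothCpt n Ω' (dilate q l u) := by
  obtain ⟨hs, hc, ht⟩ := hu
  let e : EuclideanSpace ℝ (Fin n) ≃ₜ EuclideanSpace ℝ (Fin n) :=
    Homeomorph.smulOfNeZero l hl.ne'
  refine ⟨contDiff_const.mul (hs.comp (contDiff_const_smul l)),
    (hc.comp_homeomorph e).mul_left, fun x hx => hsub x (ht ?_)⟩
  have h := tsupport_mul_subset_right (f := fun _ => l ^ (n / q)) (g := u ∘ e) hx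
  rwa [tsupport_comp_eq_preimage] at h

lemma integral_dilate_rpow {n : ℕ} {q l : ℝ} (hq : q ≠ 0) (hl : 0 < l)
    (u : EuclideanSpace ℝ (Fin n) → ℝ) :
    ∫ x, |dilate q l u x| ^ q = ∫ x, |u x| ^ q := by
  have h : ∀ x, |dilate q l u x| ^ q = l ^ n * |u (l • x)| ^ q := fun x => by
    rw [dilate, abs_mul, abs_of_pos (by positivity), Real.mul_rpow (by positivity) (abs_nonneg _),
      ← Real.rpow_mul hl.le, div_mul_cancel₀ _ hq, Real.rpow_natCast]
  simp only [h]
  rw [integral_const_mul, Measure.integral_comp_smul volume (fun y => |u y| ^ q) l,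
    finrank_euclideanSpace_fin, abs_of_pos (by positivity), smul_eq_mul,
    mul_inv_cancel_left₀ (by positivity)]

lemma norm_fderiv_dilate_sq {n : ℕ} {q l : ℝ} (hqn : 2 * (n / q) + 2 = n) (hl : 0 < l)
    {u : EuclideanSpace ℝ (Fin n) → ℝ} (hu : Differentiable ℝ u)
    (x : EuclideanSpace ℝ (Fin n)) :
    ‖fderiv ℝ (dilate q l u) x‖ ^ 2 = l ^ n * ‖fderiv ℝ u (l • x)‖ ^ 2 := by
  have hd : fderiv ℝ (dilate q l u) x = l ^ (n / q) • l • fderiv ℝ u (l • x) := by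
    rw [← fderiv_comp_smul]
    exact fderiv_const_mul (hu.comp (differentiable_id.const_smul l) x) _
  have hpow : (l ^ (n / q)) ^ 2 * l ^ 2 = l ^ n := by
    rw [← Real.rpow_natCast (l ^ (n / q)) 2, ← Real.rpow_mul hl.le, ← Real.rpow_natCast l 2,
      ← Real.rpow_add hl, ← Real.rpow_natCast l n]
    congr 1
    push_cast
    linarith
  rw [hd, norm_smul, norm_smul, Real.norm_of_nonneg hl.le, Real.norm_of_nonneg (by positivity),
    ← hpow]
  ring

lemma weight_dilate {n : ℕ} {q l β k : ℝ} (hβ : β = k * n / q) (hl : 0 < l)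
    (u : EuclideanSpace ℝ (Fin n) → ℝ) (x : EuclideanSpace ℝ (Fin n)) :
    ‖x‖ ^ β * |dilate q l u x| ^ k = ‖l • x‖ ^ β * |u (l • x)| ^ k := by
  rw [dilate, abs_mul, abs_of_pos (by positivity), Real.mul_rpow (by positivity) (abs_nonneg _),
    ← Real.rpow_mul hl.le, norm_smul, Real.norm_of_nonneg hl.le,
    Real.mul_rpow hl.le (norm_nonneg _), show (n / q * k : ℝ) = β by rw [hβ]; ring]
  ring

lemma integral_energy_dilate {n : ℕ} {q l β k : ℝ} (hqn : 2 * (n / q) + 2 = n)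
    (hβ : β = k * n / q) (hl : 0 < l) {u : EuclideanSpace ℝ (Fin n) → ℝ}
    (hu : Differentiable ℝ u) :
    ∫ x, (1 + ‖x‖ ^ β * |dilate q l u x| ^ k) * ‖fderiv ℝ (dilate q l u) x‖ ^ 2 =
      ∫ x, (1 + ‖x‖ ^ β * |u x| ^ k) * ‖fderiv ℝ u x‖ ^ 2 := by
  simp only [weight_dilate hβ hl, norm_fderiv_dilate_sq hqn hl hu, mul_left_comm _ (l ^ n)]
  rw [integral_const_mul, Measure.integral_comp_smul volume
      (fun y => (1 + ‖y‖ ^ β * |u y| ^ k) * ‖fderiv ℝ u y‖ ^ 2) l,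
    finrank_euclideanSpace_fin, abs_of_pos (by positivity), smul_eq_mul,
    mul_inv_cancel_left₀ (by positivity)]

lemma energyValues_subset {n : ℕ} {q β k : ℝ} (hq : q ≠ 0) (hqn : 2 * (n / q) + 2 = n)
    (hβ : β = k * n / q) {Ω Ω' : Set (EuclideanSpace ℝ (Fin n))}
    (hΩ : Bornology.IsBounded Ω) (hΩ' : IsOpen Ω') (h0' : 0 ∈ Ω') :
    {c | ∃ u, smoothCpt n Ω u ∧ (∫ x in Ω, |u x| ^ q) = 1 ∧ c = energy n Ω β k u} ⊆
      {c | ∃ u, smoothCpt n Ω' u ∧ (∫ x in Ω', |u x| ^ q) = 1 ∧ c = energy n Ω' β k u} := by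
  rintro c ⟨u, hu, hu1, rfl⟩
  obtain ⟨ε, hε, hball⟩ := Metric.isOpen_iff.1 hΩ' 0 h0'
  obtain ⟨R, hR, hΩR⟩ := hΩ.exists_pos_norm_lt
  have hl : 0 < R / ε := by positivity
  have hsub : ∀ x, (R / ε) • x ∈ Ω → x ∈ Ω' := fun x hx => hball <| by
    have h := hΩR _ hx
    rw [norm_smul, Real.norm_of_nonneg hl.le, div_mul_eq_mul_div, div_lt_iff₀ hε] at h
    simpa using lt_of_mul_lt_mul_left h hR.le
  have hv : smoothCpt n Ω' (dilate q (R / ε) u) := smoothCpt_dilate hl hsub hu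
  refine ⟨_, hv, ?_, ?_⟩
  · rw [setIntegral_rpow_eq_integral hv.2.2 hq, integral_dilate_rpow hq hl,
      ← setIntegral_rpow_eq_integral hu.2.2 hq, hu1]
  · rw [energy_eq_integral hv.2.2, energy_eq_integral hu.2.2,
      integral_energy_dilate hqn hβ hl (hu.1.differentiable (by simp))]

/-- Critical case `β = kn/q`: the infimum `S_Ω(β,k)` does not depend on the (smooth bounded)
domain containing the origin. -/
theorem stmt_8 (n : ℕ) (hn : 3 ≤ n) (q : ℝ) (hq : q = 2 * n / (n - 2))
    (Ω Ω' : Set (EuclideanSpace ℝ (Fin n)))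
    (hΩo : IsOpen Ω) (hΩb : Bornology.IsBounded Ω) (h0 : 0 ∈ Ω)
    (hΩo' : IsOpen Ω') (hΩb' : Bornology.IsBounded Ω') (h0' : 0 ∈ Ω')
    (β k : ℝ) (hk0 : 0 < k) (hkq : k ≤ q) (hβ : β = k * n / q) :
    Sw n Ω β k q = Sw n Ω' β k q := by
  have hn' : (3 : ℝ) ≤ n := by exact_mod_cast hn
  have hn2 : (n : ℝ) - 2 ≠ 0 := by linarith
  have hn0 : (n : ℝ) ≠ 0 := by linarith
  have hq0 : q ≠ 0 := by rw [hq]; exact div_ne_zero (by positivity) hn2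
  have hqn : 2 * (n / q) + 2 = (n : ℝ) := by
    rw [hq]
    field_simp
    ring
  exact congrArg sInf <| (energyValues_subset hq0 hqn hβ hΩb hΩo' h0').antisymm
    (energyValues_subset hq0 hqn hβ hΩb' hΩo h0)

end
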